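/- Let R be a principal ideal domain and ℘ a set of prime elements of R. Let 0 → B → M →^q A → 0 be a short exact sequence of R-modules in which A is finitely generated and ℘-torsion and B (identified with the kernel of q) is ℘-torsion-free. Suppose there exists an injective R-linear map k : A → M whose image is exactly T^℘M. Then q ∘ k : A → A is an isomorphism and the sequence splits: there exists an R-linear map s : A → M with q ∘ s = id_A. Consequently M is the internal direct sum of ker q and T^℘M, and M / T^℘M is isomorphic to B; in particular M / T^℘M is ℘-torsion-free. -/

import Mathlib

/-- The `P`-torsion submodule `T^P A` of an `R`-module `A`: the set of `x ∈ A`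
annihilated by some finite product of powers of elements of `P`
(equivalently, by some element of the multiplicative closure of `P`;
the empty product is `1`, so `T^∅ A = 0`). -/
def psetTorsion (R : Type*) [CommRing R] (P : Set R)
    (A : Type*) [AddCommGroup A] [Module R A] : Submodule R A where
  carrier := {x | ∃ n ∈ Submonoid.closure P, n • x = 0}
  zero_mem' := ⟨1, Submonoid.one_mem _, smul_zero 1⟩
  add_mem' := by
    rintro a b ⟨n, hn, hna⟩ ⟨m, hm, hmb⟩
    refine ⟨n * m, mul_mem hn hm, ?_⟩
    have h1 : (n * m) • a = 0 := by rw [mul_comm, mul_smul, hna, smul_zero]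
    have h2 : (n * m) • b = 0 := by rw [mul_smul, hmb, smul_zero]
    rw [smul_add, h1, h2, add_zero]
  smul_mem' := by
    rintro c a ⟨n, hn, hna⟩
    exact ⟨n, hn, by rw [smul_comm, hna, smul_zero]⟩

/-- A finitely generated torsion module over a principal ideal domain is Artinian. -/
theorem isArtinian_of_isTorsion_of_finite
    {R A : Type*} [CommRing R] [IsDomain R] [IsPrincipalIdealRing R]
    [AddCommGroup A] [Module R A] [Module.Finite R A] (hA : Module.IsTorsion R A) :
    IsArtinian R A := by
  obtain ⟨a, ha, ha0⟩ := Submodule.annihilator_top_inter_nonZeroDivisors hA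
  have htors : Module.IsTorsionBySet R A (Ideal.span {a} : Ideal R) := by
    rw [Module.isTorsionBySet_span_singleton_iff]
    exact fun x => Submodule.mem_annihilator.mp ha x Submodule.mem_top
  let := htors.module
  have : IsScalarTower R (R ⧸ Ideal.span {a}) A := htors.isScalarTower
  have : Module.Finite (R ⧸ Ideal.span {a}) A := .of_restrictScalars_finite R _ A
  have : IsArtinian R (R ⧸ Ideal.span {a}) :=
    (isFiniteLength_iff_isNoetherian_isArtinian.mp
      (isFiniteLength_quotient_span_singleton R ha0)).2
  have : IsArtinianRing (R ⧸ Ideal.span {a}) := isArtinian_of_tower R inferInstance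
  exact isArtinian_of_surjective_algebraMap (Ideal.Quotient.mk_surjective (I := Ideal.span {a}))

/-- If `q ∘ k` is bijective, then `ker q` and the range of `k` are complementary. -/
theorem LinearMap.isCompl_ker_range_of_comp_bijective
    {R M A : Type*} [Ring R] [AddCommGroup M] [Module R M] [AddCommGroup A] [Module R A]
    {q : M →ₗ[R] A} {k : A →ₗ[R] M} (h : Function.Bijective (q ∘ₗ k)) :
    IsCompl (LinearMap.ker q) (LinearMap.range k) := by
  constructor
  · rw [Submodule.disjoint_def]
    rintro _ hx ⟨a, rfl⟩
    rw [(injective_iff_map_eq_zero (q ∘ₗ k)).mp h.1 a hx, map_zero]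
  · rw [codisjoint_iff, eq_top_iff]
    rintro x -
    obtain ⟨a, ha⟩ := h.2 (q x)
    refine Submodule.mem_sup.mpr ⟨x - k a, ?_, k a, ⟨a, rfl⟩, sub_add_cancel _ _⟩
    rw [LinearMap.mem_ker, map_sub, sub_eq_zero]
    exact ha.symm

/-- A module embedding into a `P`-torsion-free module is `P`-torsion-free. -/
theorem psetTorsion_eq_bot_of_injective
    {R N N' : Type*} [CommRing R] {P : Set R} [AddCommGroup N] [Module R N]
    [AddCommGroup N'] [Module R N'] (f : N →ₗ[R] N') (hf : Function.Injective f)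
    (h : psetTorsion R P N' = ⊥) : psetTorsion R P N = ⊥ := by
  rw [eq_bot_iff]
  rintro x ⟨n, hn, hx⟩
  have hfx : f x ∈ psetTorsion R P N' := ⟨n, hn, by rw [← map_smul, hx, map_zero]⟩
  rw [h, Submodule.mem_bot] at hfx
  exact (injective_iff_map_eq_zero f).mp hf x hfx


/-- Over a PID `R` with `P` a set of primes of `R`: let `0 → B → M → A → 0` be a short
exact sequence (with `B` identified with `ker q` and `q : M → A` surjective) such that
`A` is finitely generated and `P`-torsion and `ker q` is `P`-torsion-free.  If
`k : A → M` is an injective linear map whose image is exactly `T^P M`, then `q ∘ k` is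
an isomorphism, the sequence splits, `M` is the internal direct sum of `ker q` and
`T^P M`, the quotient `M ⧸ T^P M` is isomorphic to `B = ker q`, and in particular
`M ⧸ T^P M` is `P`-torsion-free. -/
theorem split_of_torsion_section
    (R : Type*) [CommRing R] [IsDomain R] [IsPrincipalIdealRing R]
    (M : Type*) [AddCommGroup M] [Module R M]
    (A : Type*) [AddCommGroup A] [Module R A] [Module.Finite R A]
    (P : Set R) (hP : ∀ p ∈ P, Prime p)
    (q : M →ₗ[R] A) (hq : Function.Surjective q)
    (hA : psetTorsion R P A = ⊤)
    (hB : psetTorsion R P (LinearMap.ker q) = ⊥)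
    (k : A →ₗ[R] M) (hk : Function.Injective k)
    (hrange : LinearMap.range k = psetTorsion R P M) :
    Function.Bijective (q ∘ₗ k) ∧
      (∃ s : A →ₗ[R] M, q ∘ₗ s = LinearMap.id) ∧
      IsCompl (LinearMap.ker q) (psetTorsion R P M) ∧
      Nonempty ((M ⧸ psetTorsion R P M) ≃ₗ[R] LinearMap.ker q) ∧
      psetTorsion R P (M ⧸ psetTorsion R P M) = ⊥ := by
  have hartin : IsArtinian R A := by
    refine isArtinian_of_isTorsion_of_finite fun x => ?_
    obtain ⟨n, hn, hx⟩ : x ∈ psetTorsion R P A := hA ▸ Submodule.mem_top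
    have hP0 : P ⊆ nonZeroDivisors R := fun p hp => mem_nonZeroDivisors_of_ne_zero (hP p hp).ne_zero
    exact ⟨⟨n, (Submonoid.closure_le.mpr hP0) hn⟩, hx⟩
  have hinj : Function.Injective (q ∘ₗ k) := by
    refine (injective_iff_map_eq_zero _).mpr fun a ha => hk ?_
    obtain ⟨n, hn, hx⟩ : k a ∈ psetTorsion R P M := hrange ▸ LinearMap.mem_range_self k a
    have hmem : (⟨k a, ha⟩ : LinearMap.ker q) ∈ psetTorsion R P (LinearMap.ker q) :=
      ⟨n, hn, Subtype.ext hx⟩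
    rw [hB, Submodule.mem_bot] at hmem
    rw [map_zero]
    exact congrArg Subtype.val hmem
  have hbij : Function.Bijective (q ∘ₗ k) :=
    IsArtinian.bijective_of_injective_endomorphism _ hinj
  have hcompl : IsCompl (LinearMap.ker q) (psetTorsion R P M) :=
    hrange ▸ LinearMap.isCompl_ker_range_of_comp_bijective hbij
  let e := Submodule.quotientEquivOfIsCompl _ _ hcompl.symm
  refine ⟨hbij, ⟨k ∘ₗ (LinearEquiv.ofBijective _ hbij).symm, ?_⟩, hcompl, ⟨e⟩,
    psetTorsion_eq_bot_of_injective e.toLinearMap e.injective hB⟩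
  ext a
  exact (LinearEquiv.ofBijective _ hbij).apply_symm_apply a
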